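/- Suppose d₁d₂ ≥ 2 and let n be a positive integer with n ≤ d₁d₂/(2e⁴·ε²). Then there exist positive real numbers λ₀, …, λ_n such that Σ_{i=0}^{n} λ_i ≤ 3·d₁²·d₂²·exp(√(8nε²d₁d₂)) and, for every unitary U ∈ U(d₂−d₁), the operator Σ_{i=0}^{n} λ_i Γ_i − (vec(V_{ε,U}) vec(V_{ε,U})*)^{⊗n} is positive semidefinite. -/

import Mathlib

open scoped BigOperators ComplexOrder
open Classical Matrix MeasureTheory

noncomputable section

/-- Vectorization of a `d₂ × d₁` matrix: `vec(X) ∈ ℂ^{d₂} ⊗ ℂ^{d₁}`. -/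
def vecM {d₁ d₂ : ℕ} (X : Matrix (Fin d₂) (Fin d₁) ℂ) : Fin d₂ × Fin d₁ → ℂ :=
  fun p => X p.1 p.2

/-- Rank-one outer product `|v⟩⟨v|`. -/
def outer {ι : Type*} (v : ι → ℂ) : Matrix ι ι ℂ :=
  fun i j => v i * star (v j)

/-- The isometry `V₀ = ∑_{i=1}^{d₁} |i⟩⟨i|` from `ℂ^{d₁}` to `ℂ^{d₂}`. -/
def V0mat (d₁ d₂ : ℕ) : Matrix (Fin d₂) (Fin d₁) ℂ :=
  fun a b => if (a : ℕ) = (b : ℕ) then 1 else 0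

/-- The isometry `Δ = ∑_{i=1}^{d₁} |d₁+i⟩⟨i|` from `ℂ^{d₁}` to `ℂ^{d₂}`. -/
def Dmat (d₁ d₂ : ℕ) : Matrix (Fin d₂) (Fin d₁) ℂ :=
  fun a b => if (a : ℕ) = d₁ + (b : ℕ) then 1 else 0

/-- The block unitary `I_{d₁} ⊕ U` on `ℂ^{d₂}`. -/
def embedU (d₁ d₂ : ℕ) (U : Matrix (Fin (d₂ - d₁)) (Fin (d₂ - d₁)) ℂ) :
    Matrix (Fin d₂) (Fin d₂) ℂ :=
  fun a b =>
    if ha : d₁ ≤ (a : ℕ) then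
      if hb : d₁ ≤ (b : ℕ) then
        U ⟨(a : ℕ) - d₁, by have := a.isLt; omega⟩ ⟨(b : ℕ) - d₁, by have := b.isLt; omega⟩
      else 0
    else if (a : ℕ) = (b : ℕ) then 1 else 0

/-- The vector `|γ_i⟩ = binom(n,i)^{-1/2} ∑_{|S| = i} ⊗_j w_j` with `w_j = vec(Δ)` for `j ∈ S`
and `w_j = vec(V₀)` otherwise. -/
def gammaVec (d₁ d₂ n i : ℕ) : (Fin n → Fin d₂ × Fin d₁) → ℂ :=
  fun f => ((Real.sqrt (n.choose i) : ℂ))⁻¹ *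
    ∑ S ∈ Finset.powersetCard i (Finset.univ : Finset (Fin n)),
      ∏ j, (if j ∈ S then vecM (Dmat d₁ d₂) (f j) else vecM (V0mat d₁ d₂) (f j))

/-- The action of `((I_{d₁} ⊕ U)^{⊗n})_B` (acting as `I_{d₁} ⊕ U` on each `ℂ^{d₂}` factor and
trivially on each `ℂ^{d₁}` factor) on a vector of `(ℂ^{d₂} ⊗ ℂ^{d₁})^{⊗n}`. -/
def rotB (d₁ d₂ n : ℕ) (U : Matrix (Fin (d₂ - d₁)) (Fin (d₂ - d₁)) ℂ)
    (v : (Fin n → Fin d₂ × Fin d₁) → ℂ) : (Fin n → Fin d₂ × Fin d₁) → ℂ :=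
  fun f => ∑ g : Fin n → Fin d₂ × Fin d₁,
    (∏ j, (embedU d₁ d₂ U (f j).1 (g j).1 * (if (f j).2 = (g j).2 then (1 : ℂ) else 0))) * v g

instance matrixMeasurableSpace (ι κ : Type*) : MeasurableSpace (Matrix ι κ ℂ) :=
  MeasurableSpace.pi

/-- The Haar average `Γ_i = ∫ (I⊕U)_B^{⊗n} |γ_i⟩⟨γ_i| ((I⊕U)_B^{⊗n})^* dμ(U)`,
defined entrywise. -/
def GammaMat (d₁ d₂ n i : ℕ)
    (μ : Measure (Matrix.unitaryGroup (Fin (d₂ - d₁)) ℂ)) :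
    Matrix (Fin n → Fin d₂ × Fin d₁) (Fin n → Fin d₂ × Fin d₁) ℂ :=
  fun f g => ∫ U, rotB d₁ d₂ n (↑U) (gammaVec d₁ d₂ n i) f *
      star (rotB d₁ d₂ n (↑U) (gammaVec d₁ d₂ n i) g) ∂μ


/-- The "hard" isometry `V_{ε,U} = √(1-ε²)·V₀ + ε·(I_{d₁} ⊕ U)·Δ`. -/
def Vmat (d₁ d₂ : ℕ) (ε : ℝ) (U : Matrix (Fin (d₂ - d₁)) (Fin (d₂ - d₁)) ℂ) :
    Matrix (Fin d₂) (Fin d₁) ℂ :=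
  (Real.sqrt (1 - ε ^ 2) : ℂ) • V0mat d₁ d₂ + (ε : ℂ) • (embedU d₁ d₂ U * Dmat d₁ d₂)

/-- `n`-fold tensor power of a vector. -/
def tpow {ι : Type*} (v : ι → ℂ) (n : ℕ) : (Fin n → ι) → ℂ :=
  fun f => ∏ j, v (f j)


theorem re_trace_inv_mul_le_rank {N : Type*} [Fintype N] [DecidableEq N] {M : Matrix N N ℂ}
    (hM : M.PosSemidef) {δ : ℝ} (hδ : 0 < δ) :
    ((M + (δ : ℂ) • (1 : Matrix N N ℂ))⁻¹ * M).trace.re ≤ M.rank := by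
  set V : Matrix N N ℂ := (hM.1.eigenvectorUnitary : Matrix N N ℂ) with hV
  set e := hM.1.eigenvalues with he
  have he0 : ∀ i, 0 ≤ e i := hM.eigenvalues_nonneg
  have hVV : V * star V = 1 := (Matrix.mem_unitaryGroup_iff).1 hM.1.eigenvectorUnitary.2
  have hVV' : star V * V = 1 := (Matrix.mem_unitaryGroup_iff').1 hM.1.eigenvectorUnitary.2
  have hsp : M = V * diagonal (fun i => (e i : ℂ)) * star V := by
    conv_lhs => rw [hM.1.spectral_theorem, Unitary.conjStarAlgAut_apply]
    rfl
  have hpos : ∀ i, (e i : ℂ) + δ ≠ 0 := fun i => by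
    have := he0 i
    have h : e i + δ ≠ 0 := by positivity
    exact_mod_cast h
  have hinv : (M + (δ : ℂ) • (1 : Matrix N N ℂ))⁻¹
      = V * diagonal (fun i => ((e i : ℂ) + δ)⁻¹) * star V := by
    apply Matrix.inv_eq_right_inv
    have h1 : M + (δ : ℂ) • (1 : Matrix N N ℂ)
        = V * diagonal (fun i => (e i : ℂ) + δ) * star V := by
      have h2 : diagonal (fun i => (e i : ℂ) + δ)
          = diagonal (fun i => (e i : ℂ)) + (δ : ℂ) • (1 : Matrix N N ℂ) := by
        rw [smul_one_eq_diagonal, diagonal_add]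
      rw [h2, mul_add, add_mul, ← hsp, mul_smul_comm, mul_one, smul_mul_assoc, hVV]
    calc _ = V * diagonal (fun i => (e i : ℂ) + δ) * (star V * V)
          * diagonal (fun i => ((e i : ℂ) + δ)⁻¹) * star V := by rw [h1]; simp only [mul_assoc]
      _ = 1 := by
        rw [hVV', mul_one, mul_assoc V, diagonal_mul_diagonal]
        simp only [mul_inv_cancel₀ (hpos _)]
        rw [diagonal_one, mul_one, hVV]
  have htr : ((M + (δ : ℂ) • (1 : Matrix N N ℂ))⁻¹ * M).trace
      = ∑ i, (((e i + δ)⁻¹ * e i : ℝ) : ℂ) := by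
    calc _ = (V * diagonal (fun i => ((e i : ℂ) + δ)⁻¹) * (star V * V)
          * diagonal (fun i => (e i : ℂ)) * star V).trace := by
          rw [hinv]; conv_lhs => rw [hsp]
          simp only [mul_assoc]
      _ = _ := by
        rw [hVV', mul_one, mul_assoc V, diagonal_mul_diagonal, Matrix.trace_mul_cycle, hVV',
          one_mul, trace_diagonal]
        simp
  rw [htr, ← Complex.ofReal_sum, Complex.ofReal_re, hM.1.rank_eq_card_non_zero_eigs,
    Fintype.card_subtype, Finset.card_filter]
  push_cast
  refine Finset.sum_le_sum fun i _ => ?_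
  split_ifs with h
  · rw [inv_mul_le_iff₀ (by linarith [he0 i])]
    linarith
  · have : e i = 0 := not_not.1 h
    simp [this]

theorem norm_sq_star_dotProduct_le {N : Type*} [Fintype N] [DecidableEq N] {P : Matrix N N ℂ}
    (hP : P.PosDef) (w v : N → ℂ) :
    ‖star w ⬝ᵥ v‖ ^ 2 ≤ (star w ⬝ᵥ P *ᵥ w).re * (star v ⬝ᵥ P⁻¹ *ᵥ v).re := by
  by_cases hv : v = 0
  · simp [hv]
  have ha : 0 < (star v ⬝ᵥ P⁻¹ *ᵥ v).re :=
    (Complex.lt_def.1 (hP.inv.dotProduct_mulVec_pos hv)).1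
  set u := P⁻¹ *ᵥ v with hu
  have hPu : P *ᵥ u = v := by
    rw [hu, mulVec_mulVec, Matrix.mul_nonsing_inv _ ((Matrix.isUnit_iff_isUnit_det _).1 hP.isUnit),
      one_mulVec]
  set a := (star v ⬝ᵥ u).re with ha'
  set β := star w ⬝ᵥ v with hβ
  have huPw : star u ⬝ᵥ P *ᵥ w = star β := by
    rw [hβ, dotProduct_mulVec, ← hP.1.eq, ← star_mulVec, hPu, star_dotProduct]
  have huv : (star u ⬝ᵥ v).re = a := by
    rw [ha', star_dotProduct, dotProduct_comm]
    simp
  have key : 0 ≤ (star (w - ((a⁻¹ : ℝ) * star β) • u) ⬝ᵥ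
      P *ᵥ (w - (((a⁻¹ : ℝ) : ℂ) * star β) • u)).re :=
    (Complex.le_def.1 (hP.posSemidef.dotProduct_mulVec_nonneg _)).1
  have hex : star (w - ((a⁻¹ : ℝ) * star β) • u) ⬝ᵥ P *ᵥ (w - (((a⁻¹ : ℝ) : ℂ) * star β) • u)
      = star w ⬝ᵥ P *ᵥ w - 2 * ((a⁻¹ * ‖β‖ ^ 2 : ℝ) : ℂ)
        + ((a⁻¹ ^ 2 * ‖β‖ ^ 2 : ℝ) : ℂ) * (star u ⬝ᵥ v) := by
    have hn : ((‖β‖ ^ 2 : ℝ) : ℂ) = star β * β := by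
      rw [Complex.star_def, Complex.conj_mul']; simp
    rw [mulVec_sub, mulVec_smul, hPu, star_sub, sub_dotProduct, dotProduct_sub, dotProduct_sub,
      star_smul, smul_dotProduct, smul_dotProduct, dotProduct_smul, dotProduct_smul, huPw, ← hβ]
    rw [Complex.ofReal_mul, Complex.ofReal_mul, hn]
    simp only [smul_eq_mul, star_mul', Complex.star_def, Complex.conj_ofReal,
      Complex.conj_conj]
    push_cast
    ring
  rw [hex, Complex.add_re, Complex.sub_re, Complex.re_ofReal_mul, huv] at key
  have h2 : (2 * ((a⁻¹ * ‖β‖ ^ 2 : ℝ) : ℂ)).re = 2 * (a⁻¹ * ‖β‖ ^ 2) := by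
    norm_cast
  rw [h2] at key
  have h3 : a⁻¹ ^ 2 * ‖β‖ ^ 2 * a = a⁻¹ * ‖β‖ ^ 2 := by field_simp
  rw [h3] at key
  have h4 : a⁻¹ * ‖β‖ ^ 2 ≤ (star w ⬝ᵥ P *ᵥ w).re := by linarith
  rwa [inv_mul_le_iff₀ ha, mul_comm] at h4

/-- The second moment matrix `∫ |v⟩⟨v| dμ` of a random vector. -/
def secondMoment {G N : Type*} [MeasurableSpace G] (μ : Measure G) (v : G → N → ℂ) :
    Matrix N N ℂ :=
  fun s t => ∫ g, v g s * star (v g t) ∂μ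

section SecondMoment

variable {G N : Type*} [MeasurableSpace G] {μ : Measure G} [Fintype N] {v : G → N → ℂ}

theorem trace_mul_secondMoment
    (hint : ∀ s t, Integrable (fun g => v g s * star (v g t)) μ) (R : Matrix N N ℂ) :
    (R * secondMoment μ v).trace = ∫ g, star (v g) ⬝ᵥ R *ᵥ v g ∂μ := by
  have hi : ∀ s t, Integrable (fun g => star (v g s) * (R s t * v g t)) μ := fun s t => by
    convert! (hint t s).const_mul (R s t) using 2
    ring
  simp only [trace, diag, mul_apply, secondMoment, dotProduct, mulVec, Finset.mul_sum,
    Pi.star_apply]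
  rw [integral_finsetSum _ fun s _ => integrable_finsetSum _ fun t _ => hi s t]
  refine Finset.sum_congr rfl fun s _ => ?_
  rw [integral_finsetSum _ fun t _ => hi s t]
  refine Finset.sum_congr rfl fun t _ => ?_
  rw [← integral_const_mul]
  congr 1; ext g; ring

theorem star_dotProduct_secondMoment_mulVec
    (hint : ∀ s t, Integrable (fun g => v g s * star (v g t)) μ) (w : N → ℂ) :
    star w ⬝ᵥ secondMoment μ v *ᵥ w = ((∫ g, ‖star w ⬝ᵥ v g‖ ^ 2 ∂μ : ℝ) : ℂ) := by
  have h : star w ⬝ᵥ secondMoment μ v *ᵥ w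
      = (vecMulVec w (star w) * secondMoment μ v).trace := by
    rw [vecMulVec_mul, trace_vecMulVec, dotProduct_mulVec, dotProduct_comm]
  rw [h, trace_mul_secondMoment hint, ← integral_complex_ofReal]
  congr 1; ext g
  have hc : star (v g) ⬝ᵥ w = star (star w ⬝ᵥ v g) := by
    rw [star_dotProduct]
  rw [vecMulVec_mulVec, op_smul_eq_smul, dotProduct_smul, hc, smul_eq_mul, Complex.star_def,
    Complex.mul_conj']
  simp

theorem posSemidef_secondMoment
    (hint : ∀ s t, Integrable (fun g => v g s * star (v g t)) μ) :
    (secondMoment μ v).PosSemidef := by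
  refine .of_dotProduct_mulVec_nonneg ?_ fun w => ?_
  · ext s t
    simp only [secondMoment, conjTranspose_apply, Complex.star_def]
    rw [← integral_conj]
    congr 1; ext g; simp [mul_comm]
  · rw [star_dotProduct_secondMoment_mulVec hint]
    exact_mod_cast integral_nonneg fun g => by positivity

omit [Fintype N] in
theorem integrable_mulVec_mul_star {K : Type*} [Fintype K] {m : G → K → ℂ}
    (hint : ∀ s t, Integrable (fun g => m g s * star (m g t)) μ) (A : Matrix N K ℂ) (s t : N) :
    Integrable (fun g => (A *ᵥ m g) s * star ((A *ᵥ m g) t)) μ := by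
  simp only [mulVec, dotProduct, star_sum, Finset.sum_mul_sum]
  refine integrable_finsetSum _ fun i _ => integrable_finsetSum _ fun j _ => ?_
  convert! (hint i j).const_mul (A s i * star (A t j)) using 2
  simp; ring

omit [Fintype N] in
theorem secondMoment_mulVec {K : Type*} [Fintype K] {m : G → K → ℂ}
    (hint : ∀ s t, Integrable (fun g => m g s * star (m g t)) μ) (A : Matrix N K ℂ) :
    secondMoment μ (fun g => A *ᵥ m g) = A * secondMoment μ m * Aᴴ := by
  have hint' : ∀ s t i j,
      Integrable (fun g => A s i * m g i * star (A t j * m g j)) μ := fun s t i j => by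
    convert! (hint i j).const_mul (A s i * star (A t j)) using 2
    simp; ring
  ext s t
  simp only [secondMoment, mulVec, dotProduct, star_sum, Finset.sum_mul_sum]
  rw [integral_finsetSum _ fun i _ => integrable_finsetSum _ fun j _ => hint' s t i j]
  simp only [integral_finsetSum _ fun j _ => hint' s t _ j]
  rw [Finset.sum_comm]
  simp only [mul_apply, secondMoment, Finset.sum_mul]
  refine Finset.sum_congr rfl fun j _ => Finset.sum_congr rfl fun i _ => ?_
  rw [conjTranspose_apply, ← integral_const_mul, ← integral_mul_const]
  congr 1; ext g; simp; ring

end SecondMoment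

/-- A vector in the orbit of a unitary representation is dominated by its group average, up to
the dimension of a space through which the orbit map factors. -/
theorem norm_sq_star_dotProduct_le_card_mul_integral {G N K : Type*} [Group G] [MeasurableSpace G]
    {μ : Measure G} [IsProbabilityMeasure μ] [μ.IsMulLeftInvariant]
    (hmul : ∀ g : G, Measurable (g * ·)) [Fintype N] [DecidableEq N] [Fintype K]
    {v : G → N → ℂ} {W : G → Matrix N N ℂ} (hW : ∀ g, W g ∈ Matrix.unitaryGroup N ℂ)
    (hWv : ∀ g h, v (g * h) = W g *ᵥ v h)
    {A : Matrix N K ℂ} {m : G → K → ℂ} (hA : ∀ g, v g = A *ᵥ m g)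
    (hint : ∀ s t, Integrable (fun g => m g s * star (m g t)) μ) (g : G) (w : N → ℂ) :
    ‖star w ⬝ᵥ v g‖ ^ 2 ≤ Fintype.card K * ∫ h, ‖star w ⬝ᵥ v h‖ ^ 2 ∂μ := by
  have hintv : ∀ s t, Integrable (fun g => v g s * star (v g t)) μ := by
    simpa only [← hA] using integrable_mulVec_mul_star hint A
  set M := secondMoment μ v with hMdef
  have hM : M.PosSemidef := posSemidef_secondMoment hintv
  have hrank : M.rank ≤ Fintype.card K := by
    have : M = A * (secondMoment μ m * Aᴴ) := by
      rw [← Matrix.mul_assoc, ← secondMoment_mulVec hint]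
      simp only [← hA, hMdef]
    rw [this]
    exact (rank_mul_le_left _ _).trans (rank_le_card_width _)
  have hinv : ∀ g, W g * M * (W g)ᴴ = M := fun g => by
    rw [← secondMoment_mulVec hintv]
    simp only [← hWv]
    ext s t
    simp only [hMdef, secondMoment]
    conv_rhs => rw [← map_mul_left_eq_self μ g]
    rw [integral_map (hmul g).aemeasurable]
    rw [map_mul_left_eq_self μ g]
    exact (hintv s t).1
  have hWW' : ∀ g, (W g)ᴴ * W g = 1 := fun g => Matrix.mem_unitaryGroup_iff'.1 (hW g)
  have main : ∀ δ : ℝ, 0 < δ → ‖star w ⬝ᵥ v g‖ ^ 2 ≤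
      ((∫ h, ‖star w ⬝ᵥ v h‖ ^ 2 ∂μ) + δ * (star w ⬝ᵥ w).re) * Fintype.card K := by
    intro δ hδ
    set P := M + (δ : ℂ) • (1 : Matrix N N ℂ) with hPdef
    have hP : P.PosDef := by
      refine PosDef.posSemidef_add hM (PosDef.one.smul ?_)
      exact_mod_cast hδ
    have hPdet := (Matrix.isUnit_iff_isUnit_det _).1 hP.isUnit
    have hPinv : ∀ g, (W g)ᴴ * P⁻¹ * W g = P⁻¹ := fun g => by
      have h1 : W g * P = P * W g := by
        have : W g * M = M * W g := by
          conv_rhs => rw [← hinv g]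
          rw [mul_assoc, hWW', mul_one]
        rw [hPdef, mul_add, add_mul, this]
        simp
      have h2 : P⁻¹ * W g = W g * P⁻¹ := by
        calc P⁻¹ * W g = P⁻¹ * (W g * P) * P⁻¹ := by
              rw [mul_assoc, mul_assoc, Matrix.mul_nonsing_inv _ hPdet, mul_one]
          _ = W g * P⁻¹ := by
              rw [h1, ← mul_assoc, Matrix.nonsing_inv_mul _ hPdet, one_mul]
      rw [mul_assoc, h2, ← mul_assoc, hWW', one_mul]
    have hconst : ∀ h, star (v h) ⬝ᵥ P⁻¹ *ᵥ v h = star (v g) ⬝ᵥ P⁻¹ *ᵥ v g := fun h => by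
      have : v h = W (h * g⁻¹) *ᵥ v g := by rw [← hWv]; simp
      rw [this, star_mulVec, ← dotProduct_mulVec, mulVec_mulVec, mulVec_mulVec, hPinv]
    have htr : star (v g) ⬝ᵥ P⁻¹ *ᵥ v g = (P⁻¹ * M).trace := by
      rw [trace_mul_secondMoment hintv]
      simp [hconst]
    refine (norm_sq_star_dotProduct_le hP w (v g)).trans ?_
    rw [htr]
    have hq : (star w ⬝ᵥ P *ᵥ w).re = (∫ h, ‖star w ⬝ᵥ v h‖ ^ 2 ∂μ) + δ * (star w ⬝ᵥ w).re := by
      rw [hPdef, add_mulVec, dotProduct_add, star_dotProduct_secondMoment_mulVec hintv,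
        smul_mulVec, one_mulVec, dotProduct_smul, smul_eq_mul, Complex.add_re,
        Complex.re_ofReal_mul, Complex.ofReal_re]
    rw [← hq]
    refine mul_le_mul_of_nonneg_left ?_
      (Complex.le_def.1 (hP.posSemidef.dotProduct_mulVec_nonneg _)).1
    exact (re_trace_inv_mul_le_rank hM hδ).trans (by exact_mod_cast hrank)
  have hlim : Filter.Tendsto (fun δ : ℝ =>
      ((∫ h, ‖star w ⬝ᵥ v h‖ ^ 2 ∂μ) + δ * (star w ⬝ᵥ w).re) * Fintype.card K)
      (nhdsWithin 0 (Set.Ioi 0)) (nhds (((∫ h, ‖star w ⬝ᵥ v h‖ ^ 2 ∂μ)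
        + 0 * (star w ⬝ᵥ w).re) * Fintype.card K)) := by
    apply Filter.Tendsto.mono_left _ nhdsWithin_le_nhds
    exact Continuous.tendsto (by fun_prop) 0
  have := ge_of_tendsto hlim (Filter.eventually_of_mem self_mem_nhdsWithin main)
  rw [mul_comm]
  simpa using this

theorem sqrt_weight_le {n D i : ℕ} {ε : ℝ} (hε0 : 0 < ε) (hε1 : ε < 1)
    (hn : (n : ℝ) * ε ^ 2 ≤ D / (2 * Real.exp 4)) :
    Real.sqrt (n.choose i * (1 - ε ^ 2) ^ (n - i) * (ε ^ 2) ^ i * D.multichoose i) ≤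
      Real.sqrt (2 * (n * ε ^ 2) * D) ^ i / i.factorial + (1 / 2) ^ i := by
  set y := (n : ℝ) * ε ^ 2 with hy
  have hy0 : 0 ≤ y := by positivity
  have hf : (0 : ℝ) < i.factorial := by positivity
  have h1 : (n.choose i : ℝ) * (1 - ε ^ 2) ^ (n - i) * (ε ^ 2) ^ i ≤ y ^ i / i.factorial := by
    calc (n.choose i : ℝ) * (1 - ε ^ 2) ^ (n - i) * (ε ^ 2) ^ i
        ≤ ((n : ℝ) ^ i / i.factorial) * 1 * (ε ^ 2) ^ i := by
          have : (1 - ε ^ 2) ^ (n - i) ≤ 1 := pow_le_one₀ (by nlinarith) (by nlinarith)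
          have h0 : 0 ≤ (1 - ε ^ 2) ^ (n - i) := pow_nonneg (by nlinarith) _
          gcongr
          exact Nat.choose_le_pow_div i n
      _ = y ^ i / i.factorial := by rw [hy, mul_pow]; ring
  have h2 : (D.multichoose i : ℝ) ≤ ((D + i - 1 : ℕ) : ℝ) ^ i / i.factorial := by
    rw [Nat.multichoose_eq]
    exact Nat.choose_le_pow_div i _
  have h3 : (n.choose i : ℝ) * (1 - ε ^ 2) ^ (n - i) * (ε ^ 2) ^ i * D.multichoose i ≤
      (y ^ i / i.factorial) * (((D + i - 1 : ℕ) : ℝ) ^ i / i.factorial) := by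
    gcongr
  rcases le_or_gt i D with hi | hi
  · have h4 : Real.sqrt (n.choose i * (1 - ε ^ 2) ^ (n - i) * (ε ^ 2) ^ i * D.multichoose i) ≤
        Real.sqrt (2 * y * D) ^ i / i.factorial := by
      refine Real.sqrt_le_iff.2 ⟨by positivity, h3.trans ?_⟩
      rw [div_pow, ← pow_mul, mul_comm i 2, pow_mul, Real.sq_sqrt (by positivity),
        div_mul_div_comm, ← mul_pow, ← sq]
      have : ((D + i - 1 : ℕ) : ℝ) ≤ 2 * D := by
        have : D + i - 1 ≤ 2 * D := by omega
        exact_mod_cast this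
      have : y * ((D + i - 1 : ℕ) : ℝ) ≤ 2 * y * D := by nlinarith
      gcongr
    have : (0 : ℝ) ≤ (1 / 2) ^ i := by positivity
    linarith
  · have h4 : Real.sqrt (n.choose i * (1 - ε ^ 2) ^ (n - i) * (ε ^ 2) ^ i * D.multichoose i) ≤
        (1 / 2) ^ i := by
      refine Real.sqrt_le_iff.2 ⟨by positivity, h3.trans ?_⟩
      have hD : ((D + i - 1 : ℕ) : ℝ) ≤ 2 * i := by
        have : D + i - 1 ≤ 2 * i := by omega
        exact_mod_cast this
      have hiD : (D : ℝ) ≤ i := by exact_mod_cast hi.le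
      have hyi : y ≤ i / (2 * Real.exp 4) := hn.trans (by gcongr)
      have hst : (i : ℝ) ^ i / i.factorial ≤ Real.exp i :=
        Real.pow_div_factorial_le_exp _ (by positivity) i
      have he : (2 : ℝ) ≤ Real.exp 1 := by linarith [Real.add_one_le_exp (1 : ℝ)]
      calc (y ^ i / i.factorial) * (((D + i - 1 : ℕ) : ℝ) ^ i / i.factorial)
          ≤ ((i / (2 * Real.exp 4)) ^ i / i.factorial) * ((2 * i) ^ i / i.factorial) := by gcongr
        _ = ((i : ℝ) ^ i / i.factorial) ^ 2 / Real.exp 4 ^ i := by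
            rw [div_pow (i : ℝ), mul_pow, mul_pow]; field_simp
        _ ≤ (Real.exp i) ^ 2 / Real.exp 4 ^ i := by gcongr
        _ = ((Real.exp 1 ^ i) ^ 2)⁻¹ := by
            rw [← Real.exp_nat_mul, ← Real.exp_nat_mul, ← Real.exp_nat_mul, ← Real.exp_nat_mul,
              ← Real.exp_sub, ← Real.exp_neg]
            congr 1; push_cast; ring
        _ ≤ ((2 ^ i) ^ 2)⁻¹ := by gcongr
        _ = ((1 / 2) ^ i) ^ 2 := by rw [one_div, inv_pow, inv_pow]
    have : 0 ≤ Real.sqrt (2 * y * D) ^ i / i.factorial := by positivity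
    linarith

theorem sq_sum_sqrt_weight_le {n D : ℕ} (hD : 2 ≤ D) {ε : ℝ} (hε0 : 0 < ε) (hε1 : ε < 1)
    (hn : (n : ℝ) * ε ^ 2 ≤ D / (2 * Real.exp 4)) :
    (∑ i ∈ Finset.range (n + 1), Real.sqrt
      (n.choose i * (1 - ε ^ 2) ^ (n - i) * (ε ^ 2) ^ i * D.multichoose i)) ^ 2 ≤
      3 * (D : ℝ) ^ 2 * Real.exp (Real.sqrt (8 * n * ε ^ 2 * D)) := by
  set x := Real.sqrt (2 * (n * ε ^ 2) * D) with hx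
  have hx8 : Real.sqrt (8 * n * ε ^ 2 * D) = 2 * x := by
    rw [hx, show 8 * n * ε ^ 2 * D = 2 ^ 2 * (2 * (n * ε ^ 2) * D) by ring,
      Real.sqrt_mul (by positivity), Real.sqrt_sq (by norm_num)]
  have hS : ∑ i ∈ Finset.range (n + 1), Real.sqrt
      (n.choose i * (1 - ε ^ 2) ^ (n - i) * (ε ^ 2) ^ i * D.multichoose i) ≤ 3 * Real.exp x := by
    calc _ ≤ ∑ i ∈ Finset.range (n + 1), (x ^ i / i.factorial + (1 / 2) ^ i) :=
          Finset.sum_le_sum fun i _ => sqrt_weight_le hε0 hε1 hn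
      _ ≤ Real.exp x + 2 := by
          rw [Finset.sum_add_distrib]
          exact add_le_add (Real.sum_le_exp_of_nonneg (Real.sqrt_nonneg _) _)
            (sum_geometric_two_le _)
      _ ≤ _ := by linarith [Real.one_le_exp (Real.sqrt_nonneg (2 * (n * ε ^ 2) * D))]
  have hD' : (2 : ℝ) ≤ D := by exact_mod_cast hD
  calc _ ≤ (3 * Real.exp x) ^ 2 := by gcongr
    _ = 9 * Real.exp (2 * x) := by rw [mul_pow, ← Real.exp_nat_mul]; norm_num
    _ ≤ 3 * (D : ℝ) ^ 2 * Real.exp (2 * x) := by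
        gcongr; nlinarith
    _ = _ := by rw [hx8]

/-- The `n`-fold tensor power of a matrix. -/
def tensorPow {P : Type*} (K : Matrix P P ℂ) (n : ℕ) : Matrix (Fin n → P) (Fin n → P) ℂ :=
  fun f g => ∏ j, K (f j) (g j)

section TensorPow

variable {P : Type*} [Fintype P] {n : ℕ}

theorem tensorPow_mulVec_prod (K : Matrix P P ℂ) (w : Fin n → P → ℂ) :
    tensorPow K n *ᵥ (fun f => ∏ j, w j (f j)) = fun f => ∏ j, (K *ᵥ w j) (f j) := by
  ext f
  simp only [mulVec, dotProduct, tensorPow, Finset.prod_univ_sum, Fintype.piFinset_univ,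
    Finset.prod_mul_distrib]

theorem tensorPow_mul (K L : Matrix P P ℂ) :
    tensorPow (K * L) n = tensorPow K n * tensorPow L n := by
  ext f g
  simp only [mul_apply, tensorPow, Finset.prod_univ_sum, Fintype.piFinset_univ,
    Finset.prod_mul_distrib]

omit [Fintype P] in
theorem tensorPow_conjTranspose (K : Matrix P P ℂ) : tensorPow Kᴴ n = (tensorPow K n)ᴴ := by
  ext f g
  simp [tensorPow]

omit [Fintype P] in
theorem tensorPow_one [DecidableEq P] : tensorPow (1 : Matrix P P ℂ) n = 1 := by
  ext f g
  simp only [tensorPow, one_apply, Finset.prod_ite_zero, Finset.prod_const_one, funext_iff,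
    Finset.mem_univ, true_imp_iff]

theorem tensorPow_mem_unitaryGroup [DecidableEq P] {K : Matrix P P ℂ} (hK : K ∈ Matrix.unitaryGroup P ℂ) :
    tensorPow K n ∈ Matrix.unitaryGroup (Fin n → P) ℂ := by
  rw [Matrix.mem_unitaryGroup_iff, star_eq_conjTranspose] at hK ⊢
  rw [← tensorPow_conjTranspose, ← tensorPow_mul, hK, tensorPow_one]

end TensorPow

section EmbedU

variable {d₁ d₂ : ℕ}

theorem embedU_eq_submatrix (h : d₁ ≤ d₂) :
    ∃ e : Fin d₂ ≃ Fin d₁ ⊕ Fin (d₂ - d₁), ∀ U,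
      embedU d₁ d₂ U = (fromBlocks 1 0 0 U).submatrix e e := by
  refine ⟨(finCongr (by omega)).trans (finSumFinEquiv (m := d₁) (n := d₂ - d₁)).symm, fun U => ?_⟩
  rw [← Equiv.symm_symm ((finCongr _).trans _), ← submatrix_id_id (embedU d₁ d₂ U)]
  set e := ((finCongr (by omega : d₂ = d₁ + (d₂ - d₁))).trans
    (finSumFinEquiv (m := d₁) (n := d₂ - d₁)).symm).symm with he
  have : (embedU d₁ d₂ U).submatrix e e = fromBlocks 1 0 0 U := by
    ext x y
    rcases x with x | x <;> rcases y with y | y <;>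
      simp [he, embedU, one_apply, Fin.ext_iff]
    split_ifs <;> first | omega | rfl
  rw [← this]
  ext; simp

theorem embedU_mul (h : d₁ ≤ d₂) (U V : Matrix (Fin (d₂ - d₁)) (Fin (d₂ - d₁)) ℂ) :
    embedU d₁ d₂ (U * V) = embedU d₁ d₂ U * embedU d₁ d₂ V := by
  obtain ⟨e, he⟩ := embedU_eq_submatrix h
  rw [he, he, he, submatrix_mul_equiv, fromBlocks_multiply]
  simp

theorem embedU_mem_unitaryGroup (h : d₁ ≤ d₂) {U : Matrix (Fin (d₂ - d₁)) (Fin (d₂ - d₁)) ℂ}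
    (hU : U ∈ Matrix.unitaryGroup (Fin (d₂ - d₁)) ℂ) :
    embedU d₁ d₂ U ∈ Matrix.unitaryGroup (Fin d₂) ℂ := by
  obtain ⟨e, he⟩ := embedU_eq_submatrix h
  rw [Matrix.mem_unitaryGroup_iff, star_eq_conjTranspose] at hU ⊢
  rw [he, conjTranspose_submatrix, submatrix_mul_equiv, fromBlocks_conjTranspose,
    fromBlocks_multiply]
  simp [hU]

theorem embedU_mul_V0mat (h : d₁ ≤ d₂) (U : Matrix (Fin (d₂ - d₁)) (Fin (d₂ - d₁)) ℂ) :
    embedU d₁ d₂ U * V0mat d₁ d₂ = V0mat d₁ d₂ := by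
  ext a b
  rw [mul_apply, Finset.sum_eq_single (⟨b, by omega⟩ : Fin d₂)]
  · simp only [embedU, V0mat, if_true, mul_one]
    split_ifs <;> first | rfl | (exfalso; omega)
  · intro c _ hc
    rw [V0mat, if_neg (fun hh => hc (Fin.ext hh)), mul_zero]
  · simp

theorem embedU_mul_Dmat_apply (h : 2 * d₁ ≤ d₂) (U : Matrix (Fin (d₂ - d₁)) (Fin (d₂ - d₁)) ℂ)
    (a : Fin d₂) (b : Fin d₁) :
    (embedU d₁ d₂ U * Dmat d₁ d₂) a b = embedU d₁ d₂ U a ⟨d₁ + b, by omega⟩ := by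
  rw [mul_apply, Finset.sum_eq_single (⟨d₁ + b, by omega⟩ : Fin d₂)]
  · simp [Dmat]
  · intro c _ hc
    rw [Dmat, if_neg (fun hh => hc (Fin.ext hh)), mul_zero]
  · simp

theorem measurable_embedU_apply (a b : Fin d₂) :
    Measurable fun U : Matrix.unitaryGroup (Fin (d₂ - d₁)) ℂ => embedU d₁ d₂ U a b := by
  unfold embedU
  split_ifs
  · exact (measurable_pi_apply _).comp ((measurable_pi_apply _).comp measurable_subtype_coe)
  all_goals exact measurable_const

/-- The action of `I_{d₁} ⊕ U` on one tensor factor `ℂ^{d₂} ⊗ ℂ^{d₁}`. -/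
def siteU (d₁ d₂ : ℕ) (U : Matrix (Fin (d₂ - d₁)) (Fin (d₂ - d₁)) ℂ) :
    Matrix (Fin d₂ × Fin d₁) (Fin d₂ × Fin d₁) ℂ :=
  fun p q => embedU d₁ d₂ U p.1 q.1 * (if p.2 = q.2 then (1 : ℂ) else 0)

theorem siteU_eq_kronecker (U : Matrix (Fin (d₂ - d₁)) (Fin (d₂ - d₁)) ℂ) :
    siteU d₁ d₂ U = kroneckerMap (· * ·) (embedU d₁ d₂ U) (1 : Matrix (Fin d₁) (Fin d₁) ℂ) := by
  ext p q
  simp [siteU, one_apply]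

theorem siteU_mul (h : d₁ ≤ d₂) (U V : Matrix (Fin (d₂ - d₁)) (Fin (d₂ - d₁)) ℂ) :
    siteU d₁ d₂ (U * V) = siteU d₁ d₂ U * siteU d₁ d₂ V := by
  simp only [siteU_eq_kronecker]
  rw [← mul_kronecker_mul, embedU_mul h, mul_one]

theorem siteU_mem_unitaryGroup (h : d₁ ≤ d₂) {U : Matrix (Fin (d₂ - d₁)) (Fin (d₂ - d₁)) ℂ}
    (hU : U ∈ Matrix.unitaryGroup (Fin (d₂ - d₁)) ℂ) :
    siteU d₁ d₂ U ∈ Matrix.unitaryGroup (Fin d₂ × Fin d₁) ℂ := by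
  rw [siteU_eq_kronecker]
  exact kronecker_mem_unitary (embedU_mem_unitaryGroup h hU) (one_mem _)

theorem siteU_mulVec_vecM (U : Matrix (Fin (d₂ - d₁)) (Fin (d₂ - d₁)) ℂ)
    (X : Matrix (Fin d₂) (Fin d₁) ℂ) :
    siteU d₁ d₂ U *ᵥ vecM X = vecM (embedU d₁ d₂ U * X) := by
  ext p
  simp [siteU, mulVec, dotProduct, vecM, mul_apply, Fintype.sum_prod_type]

theorem rotB_eq_mulVec (n : ℕ) (U : Matrix (Fin (d₂ - d₁)) (Fin (d₂ - d₁)) ℂ)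
    (v : (Fin n → Fin d₂ × Fin d₁) → ℂ) :
    rotB d₁ d₂ n U v = tensorPow (siteU d₁ d₂ U) n *ᵥ v := rfl

/-- The degree-`i` monomials in the entries of `(I_{d₁} ⊕ U) Δ`. -/
def monomialVec (d₁ d₂ i : ℕ) (U : Matrix (Fin (d₂ - d₁)) (Fin (d₂ - d₁)) ℂ) :
    Sym (Fin d₂ × Fin d₁) i → ℂ :=
  fun k => ((k : Multiset (Fin d₂ × Fin d₁)).map (vecM (embedU d₁ d₂ U * Dmat d₁ d₂))).prod

/-- The coefficients expressing the rotated vector `|γ_i⟩` through the degree-`i` monomials. -/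
def monomialCoeff (d₁ d₂ n i : ℕ) :
    Matrix (Fin n → Fin d₂ × Fin d₁) (Sym (Fin d₂ × Fin d₁) i) ℂ :=
  fun f k => ((Real.sqrt (n.choose i) : ℂ))⁻¹ *
    ∑ S ∈ Finset.powersetCard i (Finset.univ : Finset (Fin n)),
      if S.val.map f = (k : Multiset (Fin d₂ × Fin d₁)) then
        ∏ j ∈ Sᶜ, vecM (V0mat d₁ d₂) (f j) else 0

theorem rotB_gammaVec (h : d₁ ≤ d₂) (n i : ℕ) (U : Matrix (Fin (d₂ - d₁)) (Fin (d₂ - d₁)) ℂ) :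
    rotB d₁ d₂ n U (gammaVec d₁ d₂ n i) = monomialCoeff d₁ d₂ n i *ᵥ monomialVec d₁ d₂ i U := by
  have hg : gammaVec d₁ d₂ n i = ((Real.sqrt (n.choose i) : ℂ))⁻¹ •
      ∑ S ∈ Finset.powersetCard i (Finset.univ : Finset (Fin n)), fun f =>
        ∏ j, (if j ∈ S then vecM (Dmat d₁ d₂) else vecM (V0mat d₁ d₂)) (f j) := by
    ext f
    simp only [gammaVec, Pi.smul_apply, Finset.sum_apply, smul_eq_mul, ite_apply]
  rw [rotB_eq_mulVec, hg, mulVec_smul, mulVec_sum]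
  ext f
  simp only [tensorPow_mulVec_prod, Pi.smul_apply, Finset.sum_apply, smul_eq_mul]
  conv_rhs =>
    simp only [mulVec, dotProduct, monomialCoeff, mul_assoc, ← Finset.mul_sum, Finset.sum_mul]
    rw [Finset.sum_comm]
  congr 1
  refine Finset.sum_congr rfl fun S hS => ?_
  have hcard : Multiset.card (S.val.map f) = i := by
    rw [Multiset.card_map]; exact (Finset.mem_powersetCard.1 hS).2
  refine Eq.trans ?_ (Finset.sum_eq_single (Sym.mk (S.val.map f) hcard) ?_ ?_).symm
  · rw [if_pos (Sym.coe_mk _ _).symm, monomialVec, ← Finset.prod_mul_prod_compl S, mul_comm]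
    congr 1
    · refine Finset.prod_congr rfl fun j hj => ?_
      have := siteU_mulVec_vecM U (V0mat d₁ d₂)
      rw [embedU_mul_V0mat h] at this
      rw [if_neg (Finset.mem_compl.1 hj)]
      exact congrFun this _
    · simp only [Sym.coe_mk, Multiset.map_map]
      refine Finset.prod_congr rfl fun j hj => ?_
      rw [if_pos hj]
      exact congrFun (siteU_mulVec_vecM U (Dmat d₁ d₂)) _
  · intro k _ hk
    rw [if_neg (fun hh => hk (Sym.coe_injective hh.symm)), zero_mul]
  · exact fun hk => absurd (Finset.mem_univ _) hk

theorem measurable_monomialVec (h : 2 * d₁ ≤ d₂) (i : ℕ) (k : Sym (Fin d₂ × Fin d₁) i) :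
    Measurable fun U : Matrix.unitaryGroup (Fin (d₂ - d₁)) ℂ => monomialVec d₁ d₂ i U k := by
  unfold monomialVec
  induction (k : Multiset (Fin d₂ × Fin d₁)) using Multiset.induction_on with
  | empty => simp
  | cons p s ih =>
    simp only [Multiset.map_cons, Multiset.prod_cons]
    refine Measurable.mul ?_ ih
    simp only [vecM, embedU_mul_Dmat_apply h]
    exact measurable_embedU_apply _ _

theorem norm_monomialVec_le (h : 2 * d₁ ≤ d₂) (i : ℕ) (k : Sym (Fin d₂ × Fin d₁) i)
    (U : Matrix.unitaryGroup (Fin (d₂ - d₁)) ℂ) : ‖monomialVec d₁ d₂ i U k‖ ≤ 1 := by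
  unfold monomialVec
  induction (k : Multiset (Fin d₂ × Fin d₁)) using Multiset.induction_on with
  | empty => simp
  | cons p s ih =>
    simp only [Multiset.map_cons, Multiset.prod_cons, norm_mul]
    refine mul_le_one₀ ?_ (norm_nonneg _) ih
    simp only [vecM, embedU_mul_Dmat_apply h]
    exact entry_norm_bound_of_unitary (embedU_mem_unitaryGroup (by omega) U.2) _ _

theorem integrable_monomialVec (h : 2 * d₁ ≤ d₂) (i : ℕ)
    {μ : Measure (Matrix.unitaryGroup (Fin (d₂ - d₁)) ℂ)} [IsFiniteMeasure μ]
    (s t : Sym (Fin d₂ × Fin d₁) i) :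
    Integrable (fun U : Matrix.unitaryGroup (Fin (d₂ - d₁)) ℂ =>
      monomialVec d₁ d₂ i U s * star (monomialVec d₁ d₂ i U t)) μ := by
  refine Integrable.of_bound (C := 1) ?_ (Filter.Eventually.of_forall fun U => ?_)
  · exact ((measurable_monomialVec h i s).mul
      (Complex.continuous_conj.measurable.comp (measurable_monomialVec h i t))).aestronglyMeasurable
  · rw [norm_mul, norm_star]
    exact mul_le_one₀ (norm_monomialVec_le h i s U) (norm_nonneg _) (norm_monomialVec_le h i t U)

end EmbedU

theorem measurable_mul_left_unitaryGroup {ι : Type*} [Fintype ι] [DecidableEq ι]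
    (g : Matrix.unitaryGroup ι ℂ) : Measurable (g * ·) := by
  refine Measurable.subtype_mk (measurable_pi_iff.2 fun a => measurable_pi_iff.2 fun b => ?_)
  simp only [mul_apply]
  refine Finset.measurable_sum _ fun c _ => Measurable.const_mul ?_ _
  exact (measurable_pi_apply _).comp ((measurable_pi_apply _).comp measurable_subtype_coe)

theorem tpow_vecM_Vmat {d₁ d₂ : ℕ} (h : d₁ ≤ d₂) {ε : ℝ} (hε0 : 0 < ε) (hε1 : ε < 1) (n : ℕ)
    (U : Matrix (Fin (d₂ - d₁)) (Fin (d₂ - d₁)) ℂ) :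
    tpow (vecM (Vmat d₁ d₂ ε U)) n = ∑ i ∈ Finset.range (n + 1),
      (Real.sqrt (n.choose i * (1 - ε ^ 2) ^ (n - i) * (ε ^ 2) ^ i) : ℂ) •
        rotB d₁ d₂ n U (gammaVec d₁ d₂ n i) := by
  have hV : vecM (Vmat d₁ d₂ ε U) = siteU d₁ d₂ U *ᵥ ((ε : ℂ) • vecM (Dmat d₁ d₂)
      + (Real.sqrt (1 - ε ^ 2) : ℂ) • vecM (V0mat d₁ d₂)) := by
    rw [mulVec_add, mulVec_smul, mulVec_smul, siteU_mulVec_vecM, siteU_mulVec_vecM,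
      embedU_mul_V0mat h, add_comm]
    rfl
  have ht : tpow (vecM (Vmat d₁ d₂ ε U)) n = rotB d₁ d₂ n U (tpow ((ε : ℂ) • vecM (Dmat d₁ d₂)
      + (Real.sqrt (1 - ε ^ 2) : ℂ) • vecM (V0mat d₁ d₂)) n) := by
    rw [rotB_eq_mulVec, hV]
    exact (tensorPow_mulVec_prod _ fun _ => _).symm
  simp only [ht, rotB_eq_mulVec, ← mulVec_smul, ← mulVec_sum]
  congr 1
  ext f
  simp only [tpow, Pi.add_apply, Pi.smul_apply, smul_eq_mul, Finset.sum_apply]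
  rw [Finset.prod_add, Finset.sum_powerset, Finset.card_univ, Fintype.card_fin]
  refine Finset.sum_congr rfl fun i hi => ?_
  have hin : i ≤ n := by simpa [Nat.lt_succ_iff] using hi
  have h1 : 0 ≤ 1 - ε ^ 2 := by nlinarith
  have hc : Real.sqrt (n.choose i) ≠ 0 := by
    have := Nat.choose_pos hin
    positivity
  have hs : Real.sqrt (n.choose i * (1 - ε ^ 2) ^ (n - i) * (ε ^ 2) ^ i)
      = Real.sqrt (n.choose i) * (Real.sqrt (1 - ε ^ 2) ^ (n - i) * ε ^ i) := by
    rw [Real.sqrt_eq_iff_eq_sq (by positivity) (by positivity), mul_pow, mul_pow,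
      Real.sq_sqrt (by positivity), pow_right_comm (Real.sqrt (1 - ε ^ 2)), Real.sq_sqrt h1]
    ring
  rw [hs, gammaVec]
  push_cast
  have hc' : (Real.sqrt (n.choose i) : ℂ) ≠ 0 := by exact_mod_cast hc
  rw [mul_comm (Real.sqrt (n.choose i) : ℂ), mul_assoc, mul_inv_cancel_left₀ hc', Finset.mul_sum]
  refine Finset.sum_congr rfl fun S hS => ?_
  have hcard := (Finset.mem_powersetCard.1 hS).2
  rw [← Finset.prod_mul_prod_compl S, Finset.prod_mul_distrib, Finset.prod_mul_distrib,
    Finset.prod_const, Finset.prod_const, hcard, ← Finset.compl_eq_univ_sdiff, Finset.card_compl,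
    hcard, Fintype.card_fin]
  rw [Finset.prod_congr rfl (fun j hj => if_pos hj),
    Finset.prod_congr rfl (fun j hj => if_neg (Finset.mem_compl.1 hj))]
  ring

theorem norm_sq_star_dotProduct_rotB_gammaVec_le {d₁ d₂ : ℕ} (h : 2 * d₁ ≤ d₂) (n i : ℕ)
    (μ : Measure (Matrix.unitaryGroup (Fin (d₂ - d₁)) ℂ)) [IsProbabilityMeasure μ]
    [μ.IsMulLeftInvariant] (U : Matrix.unitaryGroup (Fin (d₂ - d₁)) ℂ)
    (w : (Fin n → Fin d₂ × Fin d₁) → ℂ) :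
    ‖star w ⬝ᵥ rotB d₁ d₂ n U (gammaVec d₁ d₂ n i)‖ ^ 2 ≤ (d₁ * d₂).multichoose i *
      ∫ V : Matrix.unitaryGroup (Fin (d₂ - d₁)) ℂ,
        ‖star w ⬝ᵥ rotB d₁ d₂ n V (gammaVec d₁ d₂ n i)‖ ^ 2 ∂μ := by
  have hle : d₁ ≤ d₂ := by omega
  have hcov : ∀ U V : Matrix.unitaryGroup (Fin (d₂ - d₁)) ℂ,
      rotB d₁ d₂ n ↑(U * V) (gammaVec d₁ d₂ n i)
        = tensorPow (siteU d₁ d₂ U) n *ᵥ rotB d₁ d₂ n V (gammaVec d₁ d₂ n i) := fun U V => by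
    rw [rotB_eq_mulVec, rotB_eq_mulVec, mulVec_mulVec, ← tensorPow_mul, ← siteU_mul hle,
      Submonoid.coe_mul]
  have := norm_sq_star_dotProduct_le_card_mul_integral (μ := μ) measurable_mul_left_unitaryGroup
    (v := fun U : Matrix.unitaryGroup (Fin (d₂ - d₁)) ℂ => rotB d₁ d₂ n U (gammaVec d₁ d₂ n i))
    (W := fun U : Matrix.unitaryGroup (Fin (d₂ - d₁)) ℂ => tensorPow (siteU d₁ d₂ U) n)
    (fun U => tensorPow_mem_unitaryGroup (siteU_mem_unitaryGroup hle U.2))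
    hcov
    (fun U => rotB_gammaVec hle n i U) (integrable_monomialVec h i) U w
  rwa [Sym.card_sym_eq_multichoose, Fintype.card_prod, Fintype.card_fin, Fintype.card_fin,
    mul_comm d₂] at this

/-- if `n ≤ d₁d₂/(2e⁴ε²)` then there are positive `λ₀,…,λ_n` with
`∑ λ_i ≤ 3d₁²d₂²·exp(√(8nε²d₁d₂))` such that
`(vec(V_{ε,U})vec(V_{ε,U})^*)^{⊗n} ⊑ ∑ λ_i Γ_i` for every `U`. -/
theorem exists_lambda_dominating (d₁ d₂ : ℕ) (hd₁ : 0 < d₁) (hd : 2 * d₁ ≤ d₂)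
    (hdd : 2 ≤ d₁ * d₂) (ε : ℝ) (hε0 : 0 < ε) (hε1 : ε < 1) (n : ℕ) (hn : 1 ≤ n)
    (hn' : (n : ℝ) ≤ (d₁ * d₂ : ℝ) / (2 * Real.exp 4 * ε ^ 2))
    (μ : Measure (Matrix.unitaryGroup (Fin (d₂ - d₁)) ℂ)) [IsProbabilityMeasure μ]
    [μ.IsMulLeftInvariant] [μ.IsMulRightInvariant] :
    ∃ lam : ℕ → ℝ, (∀ i ≤ n, 0 < lam i) ∧
      (∑ i ∈ Finset.range (n + 1), lam i ≤
        3 * (d₁ : ℝ) ^ 2 * (d₂ : ℝ) ^ 2 * Real.exp (Real.sqrt (8 * n * ε ^ 2 * (d₁ * d₂)))) ∧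
      ∀ U : Matrix.unitaryGroup (Fin (d₂ - d₁)) ℂ,
        ((∑ i ∈ Finset.range (n + 1), (lam i : ℂ) • GammaMat d₁ d₂ n i μ) -
            outer (tpow (vecM (Vmat d₁ d₂ ε ↑U)) n)).PosSemidef := by
  have hle : d₁ ≤ d₂ := by omega
  have hε : 0 < 1 - ε ^ 2 := by nlinarith
  have hnε : (n : ℝ) * ε ^ 2 ≤ (d₁ * d₂ : ℕ) / (2 * Real.exp 4) := by
    rw [le_div_iff₀ (by positivity)] at hn' ⊢
    push_cast
    linarith
  set p : ℕ → ℝ := fun i => n.choose i * (1 - ε ^ 2) ^ (n - i) * (ε ^ 2) ^ i with hp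
  set r : ℕ → ℝ := fun i => (d₁ * d₂).multichoose i with hr
  have hp0 : ∀ i, 0 ≤ p i := fun i => by positivity
  have hpos : ∀ i ≤ n, 0 < Real.sqrt (p i * r i) := fun i hi => by
    have h1 := Nat.choose_pos hi
    have h2 : 0 < (d₁ * d₂).multichoose i := by
      rw [Nat.multichoose_eq]
      exact Nat.choose_pos (by omega)
    exact Real.sqrt_pos.2 (by positivity)
  set T := ∑ i ∈ Finset.range (n + 1), Real.sqrt (p i * r i) with hT
  refine ⟨fun i => T * Real.sqrt (p i * r i), fun i hi => mul_pos ?_ (hpos i hi), ?_, fun U => ?_⟩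
  · exact Finset.sum_pos (fun j hj => hpos j (Nat.lt_succ_iff.1 (Finset.mem_range.1 hj)))
      ⟨0, by simp⟩
  · rw [← Finset.mul_sum, ← sq]
    refine (sq_sum_sqrt_weight_le hdd hε0 hε1 hnε).trans_eq ?_
    push_cast
    ring
  · have hint : ∀ i s t, Integrable (fun V : Matrix.unitaryGroup (Fin (d₂ - d₁)) ℂ =>
        rotB d₁ d₂ n V (gammaVec d₁ d₂ n i) s * star (rotB d₁ d₂ n V (gammaVec d₁ d₂ n i) t)) μ :=
      fun i => by
        simp only [rotB_gammaVec hle]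
        exact integrable_mulVec_mul_star (integrable_monomialVec hd i) _
    have hΓ : ∀ i, GammaMat d₁ d₂ n i μ = secondMoment μ
        (fun V : Matrix.unitaryGroup (Fin (d₂ - d₁)) ℂ => rotB d₁ d₂ n V (gammaVec d₁ d₂ n i)) :=
      fun i => rfl
    set φ := tpow (vecM (Vmat d₁ d₂ ε ↑U)) n with hφ
    have houter : outer φ = vecMulVec φ (star φ) := rfl
    refine .of_dotProduct_mulVec_nonneg ?_ fun w => ?_
    · refine IsHermitian.sub ?_ (houter ▸ (posSemidef_vecMulVec_self_star φ).1)
      refine isSelfAdjoint_sum _ fun i _ => IsSelfAdjoint.smul (Complex.conj_ofReal _) ?_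
      rw [hΓ]
      exact (posSemidef_secondMoment (hint i)).1
    · set I : ℕ → ℝ := fun i => ∫ V : Matrix.unitaryGroup (Fin (d₂ - d₁)) ℂ,
        ‖star w ⬝ᵥ rotB d₁ d₂ n V (gammaVec d₁ d₂ n i)‖ ^ 2 ∂μ with hI
      have hI0 : ∀ i, 0 ≤ I i := fun i => integral_nonneg fun V => by positivity
      have hquad : star w ⬝ᵥ ((∑ i ∈ Finset.range (n + 1),
          ((T * Real.sqrt (p i * r i) : ℝ) : ℂ) • GammaMat d₁ d₂ n i μ) - outer φ) *ᵥ w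
          = ((∑ i ∈ Finset.range (n + 1), T * Real.sqrt (p i * r i) * I i
            - ‖star w ⬝ᵥ φ‖ ^ 2 : ℝ) : ℂ) := by
        rw [sub_mulVec, dotProduct_sub, sum_mulVec, dotProduct_sum, houter, vecMulVec_mulVec,
          op_smul_eq_smul, dotProduct_smul, star_dotProduct φ w, smul_eq_mul, Complex.star_def,
          Complex.conj_mul']
        simp only [smul_mulVec, dotProduct_smul, hΓ,
          star_dotProduct_secondMoment_mulVec (hint _), smul_eq_mul]
        push_cast
        rfl
      rw [hquad]
      norm_cast
      rw [sub_nonneg]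
      have hφ' : ‖star w ⬝ᵥ φ‖ ≤ ∑ i ∈ Finset.range (n + 1),
          Real.sqrt (p i * r i) * Real.sqrt (I i) := by
        rw [hφ, tpow_vecM_Vmat hle hε0 hε1, dotProduct_sum]
        refine (norm_sum_le _ _).trans (Finset.sum_le_sum fun i _ => ?_)
        rw [dotProduct_smul, norm_smul, Complex.norm_real,
          Real.norm_of_nonneg (Real.sqrt_nonneg _), Real.sqrt_mul (hp0 i), mul_assoc (Real.sqrt (p i))]
        refine mul_le_mul_of_nonneg_left ?_ (Real.sqrt_nonneg _)
        rw [← Real.sqrt_mul (by positivity)]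
        exact Real.le_sqrt_of_sq_le (norm_sq_star_dotProduct_rotB_gammaVec_le hd n i μ U w)
      calc ‖star w ⬝ᵥ φ‖ ^ 2
          ≤ (∑ i ∈ Finset.range (n + 1), Real.sqrt (p i * r i) * Real.sqrt (I i)) ^ 2 := by gcongr
        _ ≤ T * ∑ i ∈ Finset.range (n + 1), Real.sqrt (p i * r i) * I i := by
          refine Finset.sum_sq_le_sum_mul_sum_of_sq_le_mul _ (fun i _ => Real.sqrt_nonneg _)
            (fun i _ => mul_nonneg (Real.sqrt_nonneg _) (hI0 i)) fun i _ => Eq.le ?_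
          rw [mul_pow, Real.sq_sqrt (hI0 i)]
          ring
        _ = ∑ i ∈ Finset.range (n + 1), T * Real.sqrt (p i * r i) * I i := by
          simp only [Finset.mul_sum, mul_assoc]

end
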